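/- Let h₀ > 0 and let v : ℝ → ℝ be a positive, twice continuously differentiable function with h_v(0) = h₀. Then v satisfies the σ_k-Schwarzschild equation h_v(t)^{k−1}·(v(t) − α⁻²v″(t)) = 0 for all t ∈ ℝ if and only if there exists c ∈ ℝ such that v(t) = √h₀ · cosh(α t − c) for all t ∈ ℝ; in that case h_v(t) = h₀ for every t ∈ ℝ. -/

import Mathlib

noncomputable section

open Real Set

/-- α = (n−2k)/(2k) -/
def alp (n k : ℕ) : ℝ := ((n : ℝ) - 2 * (k : ℝ)) / (2 * (k : ℝ))

/-- q = 2kn/(n−2k) -/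
def qe (n k : ℕ) : ℝ := (2 * (k : ℝ) * (n : ℝ)) / ((n : ℝ) - 2 * (k : ℝ))

/-- h_v(t) = v(t)² − α⁻² v′(t)² -/
def hDel (n k : ℕ) (v : ℝ → ℝ) (t : ℝ) : ℝ :=
  (v t) ^ 2 - ((alp n k)⁻¹) ^ 2 * (deriv v t) ^ 2

/-- H_v(t) = h_v(t)^k − v(t)^q -/
def HDel (n k : ℕ) (v : ℝ → ℝ) (t : ℝ) : ℝ :=
  (hDel n k v t) ^ k - (v t) ^ (qe n k)

/-- The Delaunay ODE. -/
def DelODE (n k : ℕ) (v : ℝ → ℝ) : Prop :=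
  ∀ t : ℝ, (hDel n k v t) ^ (k - 1) * (v t - ((alp n k)⁻¹) ^ 2 * deriv (deriv v) t)
    = ((n : ℝ) / ((n : ℝ) - 2 * (k : ℝ))) * (v t) ^ (qe n k - 1)

/-- H_max = (2k/(n−2k))·((n−2k)/n)^{n/(2k)} -/
def Hmax (n k : ℕ) : ℝ :=
  (2 * (k : ℝ) / ((n : ℝ) - 2 * (k : ℝ))) *
    (((n : ℝ) - 2 * (k : ℝ)) / (n : ℝ)) ^ ((n : ℝ) / (2 * (k : ℝ)))

/-- A Delaunay solution with parameter H₀. -/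
def DelSol (n k : ℕ) (H₀ : ℝ) (v : ℝ → ℝ) : Prop :=
  ContDiff ℝ (⊤ : ℕ∞) v ∧ (∀ t, 0 < v t) ∧ DelODE n k v ∧
    deriv v 0 = 0 ∧ 0 < deriv (deriv v) 0 ∧ ∀ t, HDel n k v t = H₀

/-- F(t) = v(t)^q/(H₀ + v(t)^q) -/
def FDel (n k : ℕ) (H₀ : ℝ) (v : ℝ → ℝ) (t : ℝ) : ℝ :=
  (v t) ^ (qe n k) / (H₀ + (v t) ^ (qe n k))

/-- The coefficient a(t) of the conjugate linearized operator. -/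
def aDel (n k : ℕ) (H₀ : ℝ) (v : ℝ → ℝ) (t : ℝ) : ℝ :=
  ((n : ℝ) - (k : ℝ)) / ((k : ℝ) * ((n : ℝ) - 1)) +
    ((n : ℝ) * ((k : ℝ) - 1) / ((k : ℝ) * ((n : ℝ) - 1))) * FDel n k H₀ v t

/-- The potential p(t) of the conjugate linearized operator. -/
def pDel (n k : ℕ) (H₀ : ℝ) (v : ℝ → ℝ) (t : ℝ) : ℝ :=
  (alp n k) ^ 2
  + ((n : ℝ) * ((n : ℝ) * (k : ℝ) + (n : ℝ) - 2 * (k : ℝ)) * ((k : ℝ) - 1) /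
      (2 * (k : ℝ) ^ 2)) * FDel n k H₀ v t
  - ((n : ℝ) ^ 2 * ((k : ℝ) ^ 2 - 1) / (4 * (k : ℝ) ^ 2)) * (FDel n k H₀ v t) ^ 2
  - ((n : ℝ) * (2 * (k : ℝ) * (n : ℝ) - (n : ℝ) + 2 * (k : ℝ)) / (4 * (k : ℝ))) *
      (v t) ^ (4 * (k : ℝ) / ((n : ℝ) - 2 * (k : ℝ))) *
      (FDel n k H₀ v t) ^ (((k : ℝ) - 1) / (k : ℝ))
  + ((n : ℝ) ^ 2 * (k : ℝ) * ((k : ℝ) - 1) / (4 * (k : ℝ) ^ 2)) *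
      (v t) ^ (4 * (k : ℝ) / ((n : ℝ) - 2 * (k : ℝ))) *
      (FDel n k H₀ v t) ^ ((2 * (k : ℝ) - 1) / (k : ℝ))
lemma alp_pos {n k : ℕ} (hk : 2 ≤ 2 * k) (hkn : 2 * k < n) : 0 < alp n k := by
  have h1 : (0 : ℝ) < k := by exact_mod_cast (by omega : 0 < k)
  have h2 : 2 * (k : ℝ) < n := by exact_mod_cast hkn
  exact div_pos (by linarith) (by linarith)

lemma eq_of_hasDerivAt_zero {f : ℝ → ℝ} (hf : ∀ t, HasDerivAt f 0 t) (x y : ℝ) : f x = f y :=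
  is_const_of_deriv_eq_zero (fun t => (hf t).differentiableAt) (fun t => (hf t).deriv) x y

lemma eq_mul_exp_of_hasDerivAt {f : ℝ → ℝ} {a : ℝ} (hf : ∀ t, HasDerivAt f (a * f t) t) (t : ℝ) :
    f t = f 0 * exp (a * t) := by
  have hd : ∀ s, HasDerivAt (fun s => f s * exp (-(a * s))) 0 s := fun s => by
    have he : HasDerivAt (fun s : ℝ => -(a * s)) (-(a * 1)) s :=
      ((hasDerivAt_id s).const_mul a).neg
    exact ((hf s).mul he.exp).congr_deriv (by ring)
  have h := eq_of_hasDerivAt_zero hd t 0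
  simp only [mul_zero, neg_zero, exp_zero, mul_one] at h
  rw [← h, mul_assoc, ← exp_add]
  simp

lemma hasDerivAt_hDel {n k : ℕ} {v : ℝ → ℝ} (hv : ∀ t, HasDerivAt v (deriv v t) t)
    (hv' : ∀ t, HasDerivAt (deriv v) (deriv (deriv v) t) t) (t : ℝ) :
    HasDerivAt (hDel n k v)
      (2 * deriv v t * (v t - ((alp n k)⁻¹) ^ 2 * deriv (deriv v) t)) t := by
  refine (((hv t).pow 2).sub (((hv' t).pow 2).const_mul (((alp n k)⁻¹) ^ 2))).congr_deriv ?_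
  push_cast
  ring

/-- A positive solution of `v'' = a² v` with `v(0)² - a⁻² v'(0)² = h₀ > 0` is a translated
hyperbolic cosine. -/
lemma exists_eq_sqrt_mul_cosh {a h₀ : ℝ} (ha : a ≠ 0) (hh₀ : 0 < h₀) {v v' : ℝ → ℝ}
    (hv : ∀ t, HasDerivAt v (v' t) t) (hv' : ∀ t, HasDerivAt v' (a ^ 2 * v t) t)
    (hpos : 0 < v 0) (hinit : v 0 ^ 2 - a⁻¹ ^ 2 * v' 0 ^ 2 = h₀) :
    ∃ c : ℝ, ∀ t, v t = √h₀ * cosh (a * t - c) := by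
  have hA := eq_mul_exp_of_hasDerivAt (f := fun t => v t + a⁻¹ * v' t) (a := a) fun t => by
    refine ((hv t).add ((hv' t).const_mul a⁻¹)).congr_deriv ?_
    field_simp
    ring
  have hB := eq_mul_exp_of_hasDerivAt (f := fun t => v t - a⁻¹ * v' t) (a := -a) fun t => by
    refine ((hv t).sub ((hv' t).const_mul a⁻¹)).congr_deriv ?_
    field_simp
    ring
  set A := v 0 + a⁻¹ * v' 0 with hAdef
  set B := v 0 - a⁻¹ * v' 0 with hBdef
  have hAB : A * B = h₀ := by rw [← hinit]; ring
  have hApos : 0 < A := by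
    by_contra! hle
    have hBpos : 0 < B := by linarith
    nlinarith
  have hs : 0 < √h₀ := sqrt_pos.2 hh₀
  have hss : √h₀ ^ 2 = h₀ := sq_sqrt hh₀.le
  refine ⟨log (√h₀ / A), fun t => ?_⟩
  have h1 := hA t
  have h2 := hB t
  have h3 : v t = (A * exp (a * t) + B * exp (-a * t)) / 2 := by
    linarith
  have hB' : B = h₀ / A := by rw [← hAB]; field_simp
  rw [h3, cosh_eq, neg_sub, exp_sub, sub_eq_add_neg, exp_add, exp_log (div_pos hs hApos), neg_mul,
    hB']
  field_simp
  rw [hss]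
  ring

lemma deriv_const_mul_cosh (r a c : ℝ) :
    deriv (fun t => r * cosh (a * t - c)) = fun t => r * (sinh (a * t - c) * a) := by
  funext t
  have hl : HasDerivAt (fun t : ℝ => a * t - c) a t := by
    simpa using ((hasDerivAt_id t).const_mul a).sub_const c
  exact (hl.cosh.const_mul r).deriv

lemma deriv_const_mul_sinh (r a c : ℝ) :
    deriv (fun t => r * (sinh (a * t - c) * a)) = fun t => r * (cosh (a * t - c) * a * a) := by
  funext t
  have hl : HasDerivAt (fun t : ℝ => a * t - c) a t := by
    simpa using ((hasDerivAt_id t).const_mul a).sub_const c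
  exact ((hl.sinh.mul_const a).const_mul r).deriv

/-- classification of the σ_k-Schwarzschild solutions. -/
theorem schwarzschild_classification (n k : ℕ) (hk : 2 ≤ 2 * k) (hkn : 2 * k < n)
    (h₀ : ℝ) (hh₀ : 0 < h₀) (v : ℝ → ℝ) (hpos : ∀ t, 0 < v t)
    (hreg : ContDiff ℝ 2 v) (hinit : hDel n k v 0 = h₀) :
    ((∀ t : ℝ, (hDel n k v t) ^ (k - 1) *
        (v t - ((alp n k)⁻¹) ^ 2 * deriv (deriv v) t) = 0) ↔
      ∃ c : ℝ, ∀ t : ℝ, v t = Real.sqrt h₀ * Real.cosh (alp n k * t - c)) ∧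
    ((∀ t : ℝ, (hDel n k v t) ^ (k - 1) *
        (v t - ((alp n k)⁻¹) ^ 2 * deriv (deriv v) t) = 0) →
      ∀ t : ℝ, hDel n k v t = h₀) := by
  have ha : alp n k ≠ 0 := (alp_pos hk hkn).ne'
  have hk0 : k ≠ 0 := by omega
  have hv : ∀ t, HasDerivAt v (deriv v t) t := fun t =>
    (hreg.differentiable (by norm_num) t).hasDerivAt
  have hv' : ∀ t, HasDerivAt (deriv v) (deriv (deriv v) t) t := fun t =>
    (((contDiff_succ_iff_deriv (n := 1)).1 hreg).2.2.differentiable (by norm_num) t).hasDerivAt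
  have hlin : (∀ t : ℝ, (hDel n k v t) ^ (k - 1) *
      (v t - ((alp n k)⁻¹) ^ 2 * deriv (deriv v) t) = 0) →
      ∀ t, v t - ((alp n k)⁻¹) ^ 2 * deriv (deriv v) t = 0 := fun hode t => by
    have hd : ∀ s, HasDerivAt (fun s => hDel n k v s ^ k) 0 s := fun s => by
      refine ((hasDerivAt_hDel (n := n) (k := k) hv hv' s).pow k).congr_deriv ?_
      linear_combination ((k : ℝ) * 2 * deriv v s) * hode s
    have hpow : hDel n k v t ^ k = h₀ ^ k := hinit ▸ eq_of_hasDerivAt_zero hd t 0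
    have hne : hDel n k v t ≠ 0 := fun h0 => by
      rw [h0, zero_pow hk0] at hpow
      exact (pow_pos hh₀ k).ne hpow
    exact (mul_eq_zero.1 (hode t)).resolve_left (pow_ne_zero _ hne)
  refine ⟨⟨fun hode => ?_, ?_⟩, fun hode t => ?_⟩
  · refine exists_eq_sqrt_mul_cosh ha hh₀ hv (fun t => ?_) (hpos 0) hinit
    refine (hv' t).congr_deriv ?_
    have h := hlin hode t
    field_simp at h
    linarith
  · rintro ⟨c, hc⟩ t
    obtain rfl : v = fun t => √h₀ * cosh (alp n k * t - c) := funext hc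
    rw [deriv_const_mul_cosh, deriv_const_mul_sinh]
    refine mul_eq_zero_of_right _ ?_
    field_simp
    ring
  · rw [← hinit]
    refine eq_of_hasDerivAt_zero (fun s => ?_) t 0
    simpa only [hlin hode s, mul_zero] using hasDerivAt_hDel (n := n) (k := k) hv hv' s
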